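/- arXiv:0707.4210 — 13 statements merged into one kernel-verified Lean document; each statement's English description precedes it below -/
import Mathlib

section
/- Let n_x, n_y be positive integers and φ_x, φ_y ∈ ℝ. (Type I) For all integers k, j, setting t₁ = (−k/n_x + j/n_y)π − φ_y/n_y and t₂ = (k/n_x + j/n_y)π − φ_y/n_y, one has cos(n_x t₁ + φ_x) = cos(n_x t₂ + φ_x) and cos(n_y t₁ + φ_y) = cos(n_y t₂ + φ_y); moreover if 1 ≤ k ≤ n_x − 1 then t₁ − t₂ ∉ 2πℤ. (Type II) For all integers k, j, setting s₁ = (−k/n_y + j/n_x)π and s₂ = (k/n_y + j/n_x)π, one has cos(n_x s₁) = cos(n_x s₂) and cos(n_y s₁ + φ_y) = cos(n_y s₂ + φ_y); moreover if 1 ≤ k ≤ n_y − 1 then s₁ − s₂ ∉ 2πℤ. -/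
open Real

lemma cos_int_mul_pi_sub_eq_add (j : ℤ) (x : ℝ) : cos (j * π - x) = cos (j * π + x) := by
  rw [← cos_int_mul_two_pi_sub (j * π + x) j]
  congr 1
  ring

lemma cos_sub_int_mul_pi_eq_add (k : ℤ) (x : ℝ) : cos (x - k * π) = cos (x + k * π) := by
  rw [← cos_add_int_mul_two_pi (x - k * π) k]
  congr 1
  ring

lemma neg_two_mul_div_mul_pi_ne_two_pi_mul {n : ℕ} {k : ℤ} (hk : 1 ≤ k) (hkn : k ≤ (n : ℤ) - 1)
    (m : ℤ) : -(2 * ((k : ℝ) / n) * π) ≠ 2 * π * m := by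
  intro h
  have hn : (n : ℝ) ≠ 0 := by
    have : n ≠ 0 := by omega
    exact_mod_cast this
  have hdiv : (k : ℝ) / n = -m := by
    apply mul_left_cancel₀ (mul_ne_zero two_ne_zero pi_ne_zero)
    linear_combination -h
  have hmul : k = n * -m := by
    rw [div_eq_iff hn] at hdiv
    have : (k : ℝ) = n * -m := by linear_combination hdiv
    exact_mod_cast this
  have := Int.le_of_dvd (by omega) (Dvd.intro _ hmul.symm)
  omega

/-- Type I and Type II time pairs give double points of the xy-projection of a
Lissajous curve, and are genuine double points (times differ mod 2π) in the stated
parameter ranges. -/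
theorem lissajous_double_points_exist
    (n_x n_y : ℕ) (hx : 0 < n_x) (hy : 0 < n_y) (φ_x φ_y : ℝ) :
    (∀ k j : ℤ,
      (cos ((n_x : ℝ) * (((-(k : ℝ) / n_x + (j : ℝ) / n_y) * π) - φ_y / n_y) + φ_x) =
        cos ((n_x : ℝ) * ((((k : ℝ) / n_x + (j : ℝ) / n_y) * π) - φ_y / n_y) + φ_x)) ∧
      (cos ((n_y : ℝ) * (((-(k : ℝ) / n_x + (j : ℝ) / n_y) * π) - φ_y / n_y) + φ_y) =
        cos ((n_y : ℝ) * ((((k : ℝ) / n_x + (j : ℝ) / n_y) * π) - φ_y / n_y) + φ_y)) ∧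
      (1 ≤ k → k ≤ (n_x : ℤ) - 1 →
        ¬ ∃ m : ℤ,
          ((((-(k : ℝ) / n_x + (j : ℝ) / n_y) * π) - φ_y / n_y) -
            ((((k : ℝ) / n_x + (j : ℝ) / n_y) * π) - φ_y / n_y)) = 2 * π * m)) ∧
    (∀ k j : ℤ,
      (cos ((n_x : ℝ) * ((-(k : ℝ) / n_y + (j : ℝ) / n_x) * π)) =
        cos ((n_x : ℝ) * (((k : ℝ) / n_y + (j : ℝ) / n_x) * π))) ∧
      (cos ((n_y : ℝ) * ((-(k : ℝ) / n_y + (j : ℝ) / n_x) * π) + φ_y) =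
        cos ((n_y : ℝ) * (((k : ℝ) / n_y + (j : ℝ) / n_x) * π) + φ_y)) ∧
      (1 ≤ k → k ≤ (n_y : ℤ) - 1 →
        ¬ ∃ m : ℤ,
          (((-(k : ℝ) / n_y + (j : ℝ) / n_x) * π) -
            (((k : ℝ) / n_y + (j : ℝ) / n_x) * π)) = 2 * π * m)) := by
  have hx' : (n_x : ℝ) ≠ 0 := by positivity
  have hy' : (n_y : ℝ) ≠ 0 := by positivity
  refine ⟨fun k j => ⟨?_, ?_, ?_⟩, fun k j => ⟨?_, ?_, ?_⟩⟩
  · convert cos_sub_int_mul_pi_eq_add k (n_x * (j / n_y * π - φ_y / n_y) + φ_x) using 2 <;>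
      field_simp <;> ring
  · convert cos_int_mul_pi_sub_eq_add j (n_y * (k / n_x * π)) using 2 <;>
      field_simp <;> ring
  · rintro hk hkn ⟨m, hm⟩
    exact neg_two_mul_div_mul_pi_ne_two_pi_mul hk hkn m (by rw [← hm]; ring)
  · convert cos_int_mul_pi_sub_eq_add j (n_x * (k / n_y * π)) using 2 <;>
      field_simp <;> ring
  · convert cos_sub_int_mul_pi_eq_add k (n_y * (j / n_x * π) + φ_y) using 2 <;>
      field_simp <;> ring
  · rintro hk hkn ⟨m, hm⟩
    exact neg_two_mul_div_mul_pi_ne_two_pi_mul hk hkn m (by rw [← hm]; ring)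
end

section
/- Let n_x, n_y be relatively prime positive integers and let φ_y ∈ ℝ satisfy n_x·φ_y/π ∉ ℤ. Suppose t₁, t₂ ∈ [0, 2π) with t₁ ≠ t₂, cos(n_x t₁) = cos(n_x t₂) and cos(n_y t₁ + φ_y) = cos(n_y t₂ + φ_y). Then either (Type I) n_x(t₁ − t₂) ∈ 2πℤ and n_y(t₁ + t₂) + 2φ_y ∈ 2πℤ, or (Type II) n_y(t₁ − t₂) ∈ 2πℤ and n_x(t₁ + t₂) ∈ 2πℤ. -/
open Real

/-- If two coprime integer multiples of `d` are multiples of `p`, then so is `d`. -/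
theorem exists_eq_mul_int_of_isCoprime {a b : ℤ} (hab : IsCoprime a b) {d p : ℝ} {k l : ℤ}
    (ha : a * d = p * k) (hb : b * d = p * l) : ∃ m : ℤ, d = p * m := by
  obtain ⟨u, v, huv⟩ := hab
  have huv' : (u : ℝ) * a + v * b = 1 := by exact_mod_cast huv
  refine ⟨u * k + v * l, ?_⟩
  push_cast
  linear_combination u * ha + v * hb - d * huv'

/-- Two points of `[0, 2π)` that differ by a multiple of `2π` are equal. -/
theorem eq_of_sub_eq_two_pi_mul_int {s t : ℝ} (hs : s ∈ Set.Ico 0 (2 * π))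
    (ht : t ∈ Set.Ico 0 (2 * π)) {m : ℤ} (h : s - t = 2 * π * m) : s = t := by
  obtain ⟨hs₀, hs₁⟩ := hs
  obtain ⟨ht₀, ht₁⟩ := ht
  have hlt : (m : ℝ) < 1 := by nlinarith [pi_pos]
  have hgt : (-1 : ℝ) < m := by nlinarith [pi_pos]
  have hm : m = 0 := by
    have h₁ : m < 1 := by exact_mod_cast hlt
    have h₂ : -1 < m := by exact_mod_cast hgt
    omega
  simp only [hm, Int.cast_zero, mul_zero] at h
  linarith

/-- Classification of double points of the xy-projection of a Lissajous curve:
every double point is of Type I or Type II. -/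
theorem lissajous_double_points_classification
    (n_x n_y : ℕ) (hx : 0 < n_x) (hy : 0 < n_y)
    (hcop : Nat.Coprime n_x n_y)
    (φ_y : ℝ) (hφ : ¬ ∃ l : ℤ, (n_x : ℝ) * φ_y / π = l)
    (t₁ t₂ : ℝ) (ht₁ : t₁ ∈ Set.Ico 0 (2 * π)) (ht₂ : t₂ ∈ Set.Ico 0 (2 * π))
    (hne : t₁ ≠ t₂)
    (hcx : cos ((n_x : ℝ) * t₁) = cos ((n_x : ℝ) * t₂))
    (hcy : cos ((n_y : ℝ) * t₁ + φ_y) = cos ((n_y : ℝ) * t₂ + φ_y)) :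
    ((∃ m : ℤ, (n_x : ℝ) * (t₁ - t₂) = 2 * π * m) ∧
      (∃ m : ℤ, (n_y : ℝ) * (t₁ + t₂) + 2 * φ_y = 2 * π * m)) ∨
    ((∃ m : ℤ, (n_y : ℝ) * (t₁ - t₂) = 2 * π * m) ∧
      (∃ m : ℤ, (n_x : ℝ) * (t₁ + t₂) = 2 * π * m)) := by
  obtain ⟨k, hk | hk⟩ := cos_eq_cos_iff.mp hcx <;>
    obtain ⟨l, hl | hl⟩ := cos_eq_cos_iff.mp hcy
  · have hk' : ((n_x : ℤ) : ℝ) * (t₁ - t₂) = 2 * π * (-k : ℤ) := by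
      push_cast
      linear_combination -hk
    have hl' : ((n_y : ℤ) : ℝ) * (t₁ - t₂) = 2 * π * (-l : ℤ) := by
      push_cast
      linear_combination -hl
    obtain ⟨m, hm⟩ :=
      exists_eq_mul_int_of_isCoprime (Nat.isCoprime_iff_coprime.mpr hcop) hk' hl'
    exact absurd (eq_of_sub_eq_two_pi_mul_int ht₁ ht₂ hm) hne
  · refine Or.inl ⟨⟨-k, ?_⟩, l, ?_⟩
    · push_cast
      linear_combination -hk
    · linear_combination hl
  · refine Or.inr ⟨⟨-l, ?_⟩, k, ?_⟩
    · push_cast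
      linear_combination -hl
    · linear_combination hk
  · refine absurd ⟨n_x * l - n_y * k, ?_⟩ hφ
    rw [div_eq_iff pi_ne_zero]
    push_cast
    linear_combination (n_x : ℝ) / 2 * hl - (n_y : ℝ) / 2 * hk
end

section
/- Let n_x, n_y be relatively prime positive integers and let φ_y ∈ ℝ satisfy n_x·φ_y/π ∉ ℤ. Then the number of pairs of integers (k, j) with 1 ≤ k ≤ n_x − 1 and 1 + ⌊(n_y/n_x)k + φ_y/π⌋ ≤ j ≤ ⌊2n_y − (n_y/n_x)k + φ_y/π⌋ equals n_x·n_y − n_y. -/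
open Real

/-- The lattice points lying above finitely many columns, counted column by column. -/
theorem ncard_lattice_columns (l m : ℤ) (a b : ℤ → ℤ) :
    {p : ℤ × ℤ | l ≤ p.1 ∧ p.1 ≤ m ∧ 1 + a p.1 ≤ p.2 ∧ p.2 ≤ b p.1}.ncard
      = ∑ k ∈ Finset.Icc l m, (b k - a k).toNat := by
  have h : {p : ℤ × ℤ | l ≤ p.1 ∧ p.1 ≤ m ∧ 1 + a p.1 ≤ p.2 ∧ p.2 ≤ b p.1}
      = (((Finset.Icc l m).sigma fun k => Finset.Icc (1 + a k) (b k)).map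
          (Equiv.sigmaEquivProd ℤ ℤ).toEmbedding : Finset (ℤ × ℤ)) := by
    ext ⟨k, j⟩
    simp [and_assoc]
  rw [h, Set.ncard_coe_finset, Finset.card_map, Finset.card_sigma]
  refine Finset.sum_congr rfl fun k _ => ?_
  rw [Int.card_Icc]
  congr 1
  ring

/-- The sum of a function over `1, …, n - 1` is invariant under `k ↦ n - k`. -/
theorem sum_Icc_sub_reflect {M : Type*} [AddCommMonoid M] (n : ℤ) (g : ℤ → M) :
    ∑ k ∈ Finset.Icc 1 (n - 1), g (n - k) = ∑ k ∈ Finset.Icc 1 (n - 1), g k := by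
  refine Finset.sum_nbij' (n - ·) (n - ·) ?_ ?_ ?_ ?_ ?_ <;> intro k hk <;>
    simp only [Finset.mem_Icc, sub_sub_cancel] at hk ⊢ <;> omega

/-- The number of Type I double points of the xy-projection of a Lissajous curve
is `n_x * n_y - n_y`. -/
theorem count_typeI_double_points
    (n_x n_y : ℕ) (hx : 0 < n_x) (hy : 0 < n_y)
    (hcop : Nat.Coprime n_x n_y)
    (φ_y : ℝ) (hφ : ¬ ∃ l : ℤ, (n_x : ℝ) * φ_y / π = l) :
    {p : ℤ × ℤ | 1 ≤ p.1 ∧ p.1 ≤ (n_x : ℤ) - 1 ∧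
      1 + ⌊(n_y : ℝ) / (n_x : ℝ) * p.1 + φ_y / π⌋ ≤ p.2 ∧
      p.2 ≤ ⌊2 * (n_y : ℝ) - (n_y : ℝ) / (n_x : ℝ) * p.1 + φ_y / π⌋}.ncard
    = n_x * n_y - n_y := by
  have hx' : (n_x : ℝ) ≠ 0 := by positivity
  set g : ℤ → ℤ := fun k => ⌊(n_y : ℝ) / (n_x : ℝ) * k + φ_y / π⌋ with hg
  rw [ncard_lattice_columns 1 (n_x - 1) g
    fun k => ⌊2 * (n_y : ℝ) - (n_y : ℝ) / (n_x : ℝ) * k + φ_y / π⌋]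
  have hupper (k : ℤ) : ⌊2 * (n_y : ℝ) - (n_y : ℝ) / (n_x : ℝ) * k + φ_y / π⌋
      = n_y + g (n_x - k) := by
    rw [hg, ← Int.floor_natCast_add]
    congr 1
    push_cast
    field_simp
    ring
  have hle (k : ℤ) (hk : k ∈ Finset.Icc 1 ((n_x : ℤ) - 1)) :
      g k ≤ n_y + g (n_x - k) := by
    rw [← hupper]
    apply Int.floor_le_floor
    have hkn : (k : ℝ) ≤ n_x := by
      have := (Finset.mem_Icc.mp hk).2
      exact_mod_cast (by omega : k ≤ (n_x : ℤ))
    have : (n_y : ℝ) / n_x * k ≤ n_y / n_x * n_x := by gcongr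
    rw [div_mul_cancel₀ _ hx'] at this
    linarith
  have hsum : ((∑ k ∈ Finset.Icc 1 ((n_x : ℤ) - 1), (n_y + g (n_x - k) - g k).toNat : ℕ) : ℤ)
      = (n_x - 1) * n_y := by
    push_cast
    rw [Finset.sum_congr rfl fun k hk => Int.toNat_of_nonneg (sub_nonneg.mpr (hle k hk)),
      Finset.sum_sub_distrib, Finset.sum_add_distrib, sum_Icc_sub_reflect, add_sub_cancel_right,
      Finset.sum_const, Int.card_Icc, nsmul_eq_mul, sub_add_cancel, Int.toNat_of_nonneg (by omega)]
  simp only [hupper]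
  zify [Nat.le_mul_of_pos_left n_y hx]
  push_cast at hsum ⊢
  linarith
end

section
/- Let n_x, n_y be relatively prime positive integers and let φ_y ∈ ℝ satisfy n_x·φ_y/π ∉ ℤ. Then the set of pairs (t₁, t₂) with 0 ≤ t₁ < t₂ < 2π, cos(n_x t₁) = cos(n_x t₂) and cos(n_y t₁ + φ_y) = cos(n_y t₂ + φ_y) is finite and has exactly 2·n_x·n_y − n_x − n_y elements. -/
open Real

/-- Ordered pairs of distinct points of `[0, 1)` whose difference is a multiple of `1 / m` and
whose sum is congruent to `-c / n` modulo `1 / n`. -/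
def orderedChords (m n : ℕ) (c : ℝ) : Set (ℝ × ℝ) :=
  {p | (0 ≤ p.1 ∧ p.1 < 1) ∧ (0 ≤ p.2 ∧ p.2 < 1) ∧ p.1 ≠ p.2 ∧
    (∃ k : ℤ, (m : ℝ) * (p.2 - p.1) = k) ∧ ∃ l : ℤ, (n : ℝ) * (p.1 + p.2) + c = l}

/-- The members of `orderedChords` with increasing entries. -/
def chords (m n : ℕ) (c : ℝ) : Set (ℝ × ℝ) :=
  {p | 0 ≤ p.1 ∧ p.1 < p.2 ∧ p.2 < 1 ∧
    (∃ k : ℤ, (m : ℝ) * (p.2 - p.1) = k) ∧ ∃ l : ℤ, (n : ℝ) * (p.1 + p.2) + c = l}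

/-- The chord with difference `k / m` and sum `(j - c) / n`, reduced modulo one. -/
noncomputable def chordOfIndex (m n : ℕ) (c : ℝ) (q : ℤ × ℤ) : ℝ × ℝ :=
  (Int.fract ((q.2 - c) / (2 * n) - q.1 / (2 * m)),
    Int.fract ((q.2 - c) / (2 * n) + q.1 / (2 * m)))

/-- The index set parametrizing `orderedChords`. -/
noncomputable def chordIndices (m n : ℕ) : Finset (ℤ × ℤ) :=
  Finset.Ioo (0 : ℤ) m ×ˢ Finset.Ico (0 : ℤ) (2 * n)

theorem Int.eq_zero_of_eq_mul_of_abs_lt {d m z : ℤ} (h : d = m * z) (hd : |d| < m) : d = 0 :=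
  Int.eq_zero_of_abs_lt_dvd ⟨z, h⟩ hd

theorem injOn_chordOfIndex {m n : ℕ} (hm : 0 < m) (hn : 0 < n) (c : ℝ) :
    Set.InjOn (chordOfIndex m n c) (chordIndices m n) := by
  rintro ⟨k, j⟩ hq ⟨k', j'⟩ hq' h
  simp only [chordIndices, Finset.coe_product, Set.mem_prod, Finset.mem_coe, Finset.mem_Ioo,
    Finset.mem_Ico] at hq hq'
  simp only [chordOfIndex, Prod.mk.injEq, Int.fract_eq_fract] at h
  obtain ⟨⟨z, hz⟩, w, hw⟩ := h
  have hm' : (m : ℝ) ≠ 0 := by positivity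
  have hn' : (n : ℝ) ≠ 0 := by positivity
  have hk : k - k' = m * (w - z) := by
    have : (k - k' : ℝ) = m * (w - z) := by
      rw [← hz, ← hw]; field_simp; ring
    exact_mod_cast this
  have hk0 : k - k' = 0 :=
    Int.eq_zero_of_eq_mul_of_abs_lt hk (by rw [abs_lt]; omega)
  obtain rfl : k = k' := by omega
  have hj : j - j' = (2 * n) * z := by
    have : (j - j' : ℝ) = (2 * n) * z := by
      rw [← hz]; field_simp; ring
    exact_mod_cast this
  have hj0 : j - j' = 0 :=
    Int.eq_zero_of_eq_mul_of_abs_lt hj (by rw [abs_lt]; omega)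
  obtain rfl : j = j' := by omega
  rfl

theorem image_chordOfIndex {m n : ℕ} (hm : 0 < m) (hn : 0 < n) (c : ℝ) :
    chordOfIndex m n c '' (chordIndices m n) = orderedChords m n c := by
  have hm' : (m : ℝ) ≠ 0 := by positivity
  have hn' : (n : ℝ) ≠ 0 := by positivity
  ext ⟨x, y⟩
  constructor
  · rintro ⟨⟨k, j⟩, hq, h⟩
    simp only [chordIndices, Finset.coe_product, Set.mem_prod, Finset.mem_coe, Finset.mem_Ioo,
      Finset.mem_Ico] at hq
    simp only [chordOfIndex, Prod.mk.injEq] at h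
    obtain ⟨rfl, rfl⟩ := h
    refine ⟨⟨Int.fract_nonneg _, Int.fract_lt_one _⟩, ⟨Int.fract_nonneg _, Int.fract_lt_one _⟩,
      ?_, ?_, ?_⟩
    · intro h
      obtain ⟨z, hz⟩ := Int.fract_eq_fract.1 h
      have hk : k = m * (-z) := by
        have : (k : ℝ) = m * (-z) := by
          rw [← hz]; field_simp; ring
        exact_mod_cast this
      have := Int.eq_zero_of_eq_mul_of_abs_lt hk (by rw [abs_lt]; omega)
      omega
    · refine ⟨k - m * (⌊((j - c) / (2 * n) + k / (2 * m) : ℝ)⌋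
        - ⌊((j - c) / (2 * n) - k / (2 * m) : ℝ)⌋), ?_⟩
      simp only [Int.fract]
      push_cast
      field_simp
      ring
    · refine ⟨j - n * (⌊((j - c) / (2 * n) + k / (2 * m) : ℝ)⌋
        + ⌊((j - c) / (2 * n) - k / (2 * m) : ℝ)⌋), ?_⟩
      simp only [Int.fract]
      push_cast
      field_simp
      ring
  · rintro ⟨⟨hx0, hx1⟩, ⟨hy0, hy1⟩, hne, ⟨K, hK⟩, J, hJ⟩
    simp only at hx0 hx1 hy0 hy1 hne hK hJ
    have hmZ : (0 : ℤ) < m := by exact_mod_cast hm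
    have hnZ : (0 : ℤ) < 2 * n := by positivity
    have hKdiv := Int.emod_add_mul_ediv K m
    have hJdiv := Int.emod_add_mul_ediv (J - n * (K / m)) (2 * n)
    have hk0 := Int.emod_nonneg K hmZ.ne'
    have hk1 := Int.emod_lt_of_pos K hmZ
    have hj0 := Int.emod_nonneg (J - n * (K / m)) hnZ.ne'
    have hj1 := Int.emod_lt_of_pos (J - n * (K / m)) hnZ
    generalize hk : K % m = k at *
    generalize hq : K / m = q at *
    generalize hj : (J - n * q) % (2 * n) = j at *
    generalize hr : (J - n * q) / (2 * n) = r at *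
    have hKdiv' : (k + m * q : ℝ) = K := by exact_mod_cast hKdiv
    have hJdiv' : (j + 2 * n * r : ℝ) = J - n * q := by exact_mod_cast hJdiv
    have hyx : y - x = k / m + q := by
      field_simp; linarith
    have hxy : y + x = (j - c) / n + 2 * r + q := by
      field_simp; linarith
    have hkne : k ≠ 0 := by
      rintro rfl
      have h1 : y - x = q := by simpa using hyx
      have h2 : q < 1 := by
        have : (q : ℝ) < 1 := by linarith
        exact_mod_cast this
      have h3 : -1 < q := by
        have : (-1 : ℝ) < q := by linarith
        exact_mod_cast this
      obtain rfl : q = 0 := by omega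
      apply hne
      simp at h1
      linarith
    have e1 : ((j - c) / (2 * n) : ℝ) = (j - c) / n / 2 := by field_simp
    have e2 : (k / (2 * m) : ℝ) = k / m / 2 := by field_simp
    refine ⟨(k, j), ?_, ?_⟩
    · simp only [chordIndices, Finset.coe_product, Set.mem_prod, Finset.mem_coe, Finset.mem_Ioo,
        Finset.mem_Ico]
      omega
    · simp only [chordOfIndex, Prod.mk.injEq, Int.fract_eq_iff]
      refine ⟨⟨hx0, hx1, -r, ?_⟩, hy0, hy1, -r - q, ?_⟩ <;>
      · rw [e1, e2]; push_cast; linarith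

theorem finite_orderedChords {m n : ℕ} (hm : 0 < m) (hn : 0 < n) (c : ℝ) :
    (orderedChords m n c).Finite := by
  rw [← image_chordOfIndex hm hn]
  exact (Finset.finite_toSet _).image _

theorem ncard_orderedChords {m n : ℕ} (hm : 0 < m) (hn : 0 < n) (c : ℝ) :
    (orderedChords m n c).ncard = (m - 1) * (2 * n) := by
  rw [← image_chordOfIndex hm hn, (injOn_chordOfIndex hm hn c).ncard_image,
    Set.ncard_coe_finset, chordIndices, Finset.card_product, Int.card_Ioo, Int.card_Ico]
  congr 1
  all_goals omega

theorem orderedChords_eq_union (m n : ℕ) (c : ℝ) :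
    orderedChords m n c = chords m n c ∪ Prod.swap '' chords m n c := by
  ext ⟨x, y⟩
  simp only [Set.image_swap_eq_preimage_swap, Set.mem_union, Set.mem_preimage, Prod.swap_prod_mk,
    orderedChords, chords, Set.mem_ofPred_eq]
  constructor
  · rintro ⟨⟨hx0, hx1⟩, ⟨hy0, hy1⟩, hne, ⟨k, hk⟩, l, hl⟩
    rcases lt_or_gt_of_ne hne with h | h
    · exact Or.inl ⟨hx0, h, hy1, ⟨k, hk⟩, l, hl⟩
    · exact Or.inr ⟨hy0, h, hx1, ⟨-k, by push_cast; linarith⟩, l, by rw [← hl]; ring⟩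
  · rintro (⟨h0, h, h1, ⟨k, hk⟩, l, hl⟩ | ⟨h0, h, h1, ⟨k, hk⟩, l, hl⟩)
    · exact ⟨⟨h0, by linarith⟩, ⟨by linarith, h1⟩, h.ne, ⟨k, hk⟩, l, hl⟩
    · exact ⟨⟨by linarith, h1⟩, ⟨h0, by linarith⟩, h.ne', ⟨-k, by push_cast; linarith⟩, l,
        by rw [← hl]; ring⟩

theorem finite_chords {m n : ℕ} (hm : 0 < m) (hn : 0 < n) (c : ℝ) : (chords m n c).Finite :=
  (finite_orderedChords hm hn c).subset
    (by rw [orderedChords_eq_union]; exact Set.subset_union_left)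

theorem ncard_chords {m n : ℕ} (hm : 0 < m) (hn : 0 < n) (c : ℝ) :
    (chords m n c).ncard = (m - 1) * n := by
  have hfin := finite_chords hm hn c
  have hdisj : Disjoint (chords m n c) (Prod.swap '' chords m n c) := by
    rw [Set.disjoint_left]
    rintro _ ⟨_, h, _⟩ ⟨_, ⟨_, h', _⟩, rfl⟩
    exact lt_asymm h h'
  have h := ncard_orderedChords hm hn c
  rw [orderedChords_eq_union, Set.ncard_union_eq hdisj hfin (hfin.image _),
    Set.ncard_image_of_injective _ Prod.swap_injective] at h
  linarith

theorem exists_int_eq_of_coprime_mul {a b : ℕ} (h : Nat.Coprime a b) {x : ℝ} {k l : ℤ}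
    (hk : a * x = k) (hl : b * x = l) : ∃ z : ℤ, x = z := by
  refine ⟨k * a.gcdA b + l * a.gcdB b, ?_⟩
  have hb : (1 : ℝ) = a * a.gcdA b + b * a.gcdB b := by
    have := Nat.gcd_eq_gcd_ab a b
    rw [h.gcd_eq_one] at this
    exact_mod_cast this
  push_cast
  rw [← hk, ← hl]
  linear_combination x * hb

theorem disjoint_chords {a b : ℕ} (h : Nat.Coprime a b) (c d : ℝ) :
    Disjoint (chords a b c) (chords b a d) := by
  rw [Set.disjoint_left]
  rintro ⟨x, y⟩ ⟨h0, hlt, h1, ⟨k, hk⟩, -⟩ ⟨-, -, -, ⟨l, hl⟩, -⟩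
  simp only at h0 hlt h1 hk hl
  obtain ⟨z, hz⟩ := exists_int_eq_of_coprime_mul h hk hl
  have hz0 : (0 : ℝ) < z := by linarith
  have hz1 : (z : ℝ) < 1 := by linarith
  norm_cast at hz0 hz1
  omega

theorem cos_two_pi_mul_eq_iff (n : ℕ) (x y φ : ℝ) :
    cos (n * (2 * π * x) + φ) = cos (n * (2 * π * y) + φ) ↔
      (∃ k : ℤ, (n : ℝ) * (y - x) = k) ∨ ∃ l : ℤ, (n : ℝ) * (x + y) + φ / π = l := by
  have hπ := pi_ne_zero
  have key : ∀ u v : ℝ, 2 * π * u = 2 * π * v ↔ u = v := fun u v =>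
    mul_right_inj' (by positivity)
  rw [cos_eq_cos_iff, exists_or]
  refine or_congr (exists_congr fun k => ?_) (exists_congr fun k => ?_)
  · rw [← key (n * (y - x))]
    constructor <;> intro h <;> linarith
  · rw [← key (n * (x + y) + φ / π)]
    have : 2 * π * (n * (x + y) + φ / π) = 2 * π * (n * (x + y)) + 2 * φ := by field_simp
    rw [this]
    constructor <;> intro h <;> linarith

theorem lissajous_doublePoints_eq_image
    {a b : ℕ} (hcop : Nat.Coprime a b) {φ : ℝ} (hφ : ¬ ∃ l : ℤ, (a : ℝ) * φ / π = l) :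
    {p : ℝ × ℝ | 0 ≤ p.1 ∧ p.1 < p.2 ∧ p.2 < 2 * π ∧
        cos ((a : ℝ) * p.1) = cos ((a : ℝ) * p.2) ∧
        cos ((b : ℝ) * p.1 + φ) = cos ((b : ℝ) * p.2 + φ)} =
      (fun p : ℝ × ℝ => (2 * π * p.1, 2 * π * p.2)) '' (chords a b (φ / π) ∪ chords b a 0) := by
  have hπ : 0 < 2 * π := by positivity
  have hmem : ∀ x y : ℝ, (0 ≤ 2 * π * x ∧ 2 * π * x < 2 * π * y ∧ 2 * π * y < 2 * π ∧
      cos (a * (2 * π * x)) = cos (a * (2 * π * y)) ∧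
      cos (b * (2 * π * x) + φ) = cos (b * (2 * π * y) + φ)) ↔
      (x, y) ∈ chords a b (φ / π) ∪ chords b a 0 := by
    intro x y
    have ha := cos_two_pi_mul_eq_iff a x y 0
    simp only [add_zero, zero_div] at ha
    rw [ha, cos_two_pi_mul_eq_iff, mul_nonneg_iff_of_pos_left hπ, mul_lt_mul_iff_right₀ hπ,
      mul_lt_iff_lt_one_right hπ]
    simp only [chords, Set.mem_union, Set.mem_ofPred_eq, add_zero]
    constructor
    · rintro ⟨h0, hlt, h1, ⟨k, hk⟩ | ⟨k, hk⟩, ⟨l, hl⟩ | ⟨l, hl⟩⟩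
      · obtain ⟨z, hz⟩ := exists_int_eq_of_coprime_mul hcop hk hl
        have hz0 : (0 : ℝ) < z := by linarith
        have hz1 : (z : ℝ) < 1 := by linarith
        norm_cast at hz0 hz1
        omega
      · exact Or.inl ⟨h0, hlt, h1, ⟨k, hk⟩, l, hl⟩
      · exact Or.inr ⟨h0, hlt, h1, ⟨l, hl⟩, k, hk⟩
      · refine absurd ⟨a * l - b * k, ?_⟩ hφ
        push_cast
        rw [← hk, ← hl]
        ring
    · rintro (⟨h0, hlt, h1, hk, hl⟩ | ⟨h0, hlt, h1, hk, hl⟩)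
      · exact ⟨h0, hlt, h1, Or.inl hk, Or.inr hl⟩
      · exact ⟨h0, hlt, h1, Or.inr hl, Or.inl hk⟩
  ext ⟨s, t⟩
  constructor
  · intro h
    have hs : 2 * π * (s / (2 * π)) = s := by field_simp
    have ht : 2 * π * (t / (2 * π)) = t := by field_simp
    refine ⟨(s / (2 * π), t / (2 * π)), (hmem _ _).1 ?_, Prod.ext hs ht⟩
    rw [hs, ht]
    exact h
  · rintro ⟨⟨x, y⟩, h, he⟩
    rw [← he]
    exact (hmem x y).2 h

/-- The xy-projection of a Lissajous curve has exactly `2*n_x*n_y - n_x - n_y`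
double points. -/
theorem count_all_double_points
    (n_x n_y : ℕ) (hx : 0 < n_x) (hy : 0 < n_y)
    (hcop : Nat.Coprime n_x n_y)
    (φ_y : ℝ) (hφ : ¬ ∃ l : ℤ, (n_x : ℝ) * φ_y / π = l) :
    {p : ℝ × ℝ | 0 ≤ p.1 ∧ p.1 < p.2 ∧ p.2 < 2 * π ∧
        cos ((n_x : ℝ) * p.1) = cos ((n_x : ℝ) * p.2) ∧
        cos ((n_y : ℝ) * p.1 + φ_y) = cos ((n_y : ℝ) * p.2 + φ_y)}.Finite ∧
    {p : ℝ × ℝ | 0 ≤ p.1 ∧ p.1 < p.2 ∧ p.2 < 2 * π ∧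
        cos ((n_x : ℝ) * p.1) = cos ((n_x : ℝ) * p.2) ∧
        cos ((n_y : ℝ) * p.1 + φ_y) = cos ((n_y : ℝ) * p.2 + φ_y)}.ncard
      = 2 * n_x * n_y - n_x - n_y := by
  have hinj : Function.Injective (fun p : ℝ × ℝ => (2 * π * p.1, 2 * π * p.2)) := by
    rintro ⟨x, y⟩ ⟨x', y'⟩ h
    simpa [pi_ne_zero] using h
  have h₁ := finite_chords hx hy (φ_y / π)
  have h₂ := finite_chords hy hx 0
  rw [lissajous_doublePoints_eq_image hcop hφ]
  refine ⟨(h₁.union h₂).image _, ?_⟩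
  rw [Set.ncard_image_of_injective _ hinj, Set.ncard_union_eq (disjoint_chords hcop _ _) h₁ h₂,
    ncard_chords hx hy, ncard_chords hy hx]
  obtain ⟨a, rfl⟩ := Nat.exists_eq_add_of_lt hx
  obtain ⟨b, rfl⟩ := Nat.exists_eq_add_of_lt hy
  simp only [zero_add, Nat.add_sub_cancel]
  rw [Nat.sub_sub]
  refine Nat.eq_sub_of_add_eq ?_
  ring
end

section
/- Let n_x, n_y, n_z be pairwise relatively prime positive integers and let φ_y, φ_z ∈ ℝ satisfy: n_x·φ_y/π ∉ ℤ, n_x·φ_z/π ∉ ℤ, and (n_y·φ_z − n_z·φ_y)/π ∉ ℤ. Then the map t ↦ (cos(n_x t), cos(n_y t + φ_y), cos(n_z t + φ_z)) is injective on [0, 2π). -/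
open Real

/-- If two coprime multiples of `d` are integer multiples of `c`, then so is `d`. -/
theorem exists_int_mul_of_coprime {a b : ℕ} (hab : Nat.Coprime a b) {d c : ℝ} {k m : ℤ}
    (ha : (a : ℝ) * d = k * c) (hb : (b : ℝ) * d = m * c) : ∃ j : ℤ, d = j * c := by
  refine ⟨k * a.gcdA b + m * a.gcdB b, ?_⟩
  have h : (1 : ℝ) = a * a.gcdA b + b * a.gcdB b := by
    have := Nat.gcd_eq_gcd_ab a b
    rw [hab.gcd_eq_one] at this
    exact_mod_cast this
  push_cast
  linear_combination d * h + (a.gcdA b : ℝ) * ha + (a.gcdB b : ℝ) * hb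

/-- Two points of `[0, 2π)` whose difference has two coprime multiples in `2πℤ` are equal. -/
theorem eq_of_coprime_mul_sub {a b : ℕ} (hab : Nat.Coprime a b) {s t : ℝ}
    (hs : s ∈ Set.Ico 0 (2 * π)) (ht : t ∈ Set.Ico 0 (2 * π)) {k m : ℤ}
    (ha : (a : ℝ) * (t - s) = k * (2 * π)) (hb : (b : ℝ) * (t - s) = m * (2 * π)) :
    s = t := by
  obtain ⟨j, hj⟩ := exists_int_mul_of_coprime hab ha hb
  have hlt : (j : ℝ) < 1 := by
    by_contra! h
    nlinarith [pi_pos, hs.1, ht.2]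
  have hgt : (-1 : ℝ) < j := by
    by_contra! h
    nlinarith [pi_pos, hs.2, ht.1]
  have hj0 : j = 0 := by
    have h₁ : j < 1 := by exact_mod_cast hlt
    have h₂ : -1 < j := by exact_mod_cast hgt
    omega
  rw [hj0] at hj
  push_cast at hj
  linarith

/-- Equality of the cosines of two phases means the times differ, or the phases sum, to a period. -/
theorem exists_int_of_cos_phase_eq {n φ s t : ℝ} (h : cos (n * s + φ) = cos (n * t + φ)) :
    ∃ k : ℤ, n * (t - s) = k * (2 * π) ∨ n * (s + t) + 2 * φ = k * (2 * π) := by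
  obtain ⟨k, hk | hk⟩ := cos_eq_cos_iff.1 h
  · exact ⟨k, Or.inl (by linarith)⟩
  · exact ⟨k, Or.inr (by linarith)⟩

/-- If the phase shifts avoid all the singular lines, the Lissajous curve is
injective on `[0, 2π)`. -/
theorem lissajous_injective
    (n_x n_y n_z : ℕ) (hx : 0 < n_x) (hy : 0 < n_y) (hz : 0 < n_z)
    (hxy : Nat.Coprime n_x n_y) (hxz : Nat.Coprime n_x n_z) (hyz : Nat.Coprime n_y n_z)
    (φ_y φ_z : ℝ)
    (h1 : ¬ ∃ l : ℤ, (n_x : ℝ) * φ_y / π = l)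
    (h2 : ¬ ∃ l : ℤ, (n_x : ℝ) * φ_z / π = l)
    (h3 : ¬ ∃ l : ℤ, ((n_y : ℝ) * φ_z - (n_z : ℝ) * φ_y) / π = l) :
    Set.InjOn
      (fun t : ℝ =>
        (cos ((n_x : ℝ) * t), cos ((n_y : ℝ) * t + φ_y), cos ((n_z : ℝ) * t + φ_z)))
      (Set.Ico 0 (2 * π)) := by
  intro s hs t ht hst
  simp only [Prod.mk.injEq] at hst
  obtain ⟨ex, ey, ez⟩ := hst
  obtain ⟨k, hk⟩ := exists_int_of_cos_phase_eq (n := n_x) (φ := 0) (by simpa using ex)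
  obtain ⟨l, hl⟩ := exists_int_of_cos_phase_eq ey
  obtain ⟨m, hm⟩ := exists_int_of_cos_phase_eq ez
  have hπ := pi_ne_zero
  rcases hk with hk | hk <;> rcases hl with hl | hl
  · exact eq_of_coprime_mul_sub hxy hs ht hk hl
  · rcases hm with hm | hm
    · exact eq_of_coprime_mul_sub hxz hs ht hk hm
    · refine absurd ⟨n_y * m - n_z * l, ?_⟩ h3
      rw [div_eq_iff hπ]
      push_cast
      linear_combination (n_y / 2 : ℝ) * hm - (n_z / 2 : ℝ) * hl
  · rcases hm with hm | hm
    · exact eq_of_coprime_mul_sub hyz hs ht hl hm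
    · refine absurd ⟨n_x * m - n_z * k, ?_⟩ h2
      rw [div_eq_iff hπ]
      push_cast
      linear_combination (n_x / 2 : ℝ) * hm - (n_z / 2 : ℝ) * hk
  · refine absurd ⟨n_x * l - n_y * k, ?_⟩ h1
    rw [div_eq_iff hπ]
    push_cast
    linear_combination (n_x / 2 : ℝ) * hl - (n_y / 2 : ℝ) * hk
end

section
/- Let n_x, n_y, n_z be pairwise relatively prime positive integers with n_x ≥ 2, and let φ_y, φ_z ∈ ℝ satisfy (n_y·φ_z − n_z·φ_y)/π ∈ ℤ. Then there exist t₁, t₂ ∈ [0, 2π) with t₁ ≠ t₂ such that cos(n_x t₁) = cos(n_x t₂), cos(n_y t₁ + φ_y) = cos(n_y t₂ + φ_y), and cos(n_z t₁ + φ_z) = cos(n_z t₂ + φ_z). -/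
open Real

/-- Reducing the argument modulo `2π` does not change the cosine at an integer frequency. -/
lemma cos_natCast_mul_toIcoMod_add (n : ℕ) (t φ : ℝ) :
    cos (n * toIcoMod two_pi_pos 0 t + φ) = cos (n * t + φ) := by
  rw [cos_eq_cos_iff]
  refine ⟨n * toIcoDiv two_pi_pos 0 t, Or.inl ?_⟩
  rw [toIcoMod, zsmul_eq_mul]
  push_cast
  ring

/-- The cosine is symmetric about a phase that is an integer multiple of `π`. -/
lemma cos_mul_add_eq_cos_mul_sub {n s φ : ℝ} {m : ℤ} (h : n * s + φ = m * π) (d : ℝ) :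
    cos (n * (s + d) + φ) = cos (n * (s - d) + φ) := by
  rw [cos_eq_cos_iff]
  exact ⟨m, Or.inr (by linear_combination 2 * h)⟩

/-- If the phase shifts lie on a diagonal singular line, the Lissajous curve has a
self-intersection. -/
theorem lissajous_self_intersection_on_diagonal_line
    (n_x n_y n_z : ℕ) (hx : 2 ≤ n_x) (hy : 0 < n_y) (hz : 0 < n_z)
    (hxy : Nat.Coprime n_x n_y) (hxz : Nat.Coprime n_x n_z) (hyz : Nat.Coprime n_y n_z)
    (φ_y φ_z : ℝ)
    (hsing : ∃ l : ℤ, ((n_y : ℝ) * φ_z - (n_z : ℝ) * φ_y) / π = l) :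
    ∃ t₁ ∈ Set.Ico (0 : ℝ) (2 * π), ∃ t₂ ∈ Set.Ico (0 : ℝ) (2 * π),
      t₁ ≠ t₂ ∧
      cos ((n_x : ℝ) * t₁) = cos ((n_x : ℝ) * t₂) ∧
      cos ((n_y : ℝ) * t₁ + φ_y) = cos ((n_y : ℝ) * t₂ + φ_y) ∧
      cos ((n_z : ℝ) * t₁ + φ_z) = cos ((n_z : ℝ) * t₂ + φ_z) := by
  obtain ⟨l, hl⟩ := hsing
  rw [div_eq_iff pi_ne_zero] at hl
  obtain ⟨u, v, huv⟩ := Nat.isCoprime_iff_coprime.mpr hyz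
  have huv' : (u : ℝ) * n_y + v * n_z = 1 := by exact_mod_cast huv
  have hx0 : (n_x : ℝ) ≠ 0 := by positivity
  set s : ℝ := -(u * φ_y + v * φ_z) with hs
  have hsy : (n_y : ℝ) * s + φ_y = ((-v * l : ℤ) : ℝ) * π := by
    push_cast
    linear_combination n_y * hs - φ_y * huv' - v * hl
  have hsz : (n_z : ℝ) * s + φ_z = ((u * l : ℤ) : ℝ) * π := by
    push_cast
    linear_combination n_z * hs - φ_z * huv' + u * hl
  have mem (t : ℝ) : toIcoMod two_pi_pos 0 t ∈ Set.Ico (0 : ℝ) (2 * π) := by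
    simpa using toIcoMod_mem_Ico two_pi_pos 0 t
  refine ⟨_, mem (s + π / n_x), _, mem (s - π / n_x), fun h ↦ ?_, ?_, ?_, ?_⟩
  · obtain ⟨j, k, hk⟩ := (toIcoMod_inj two_pi_pos).mp h
    rw [nsmul_eq_mul, nsmul_eq_mul] at hk
    have hdiv : π / n_x * n_x = π := div_mul_cancel₀ π hx0
    have hmul : ((n_x * (k - j) : ℤ) : ℝ) = (1 : ℤ) := by
      push_cast
      refine mul_left_cancel₀ two_pi_pos.ne' ?_
      linear_combination -n_x * hk + 2 * hdiv
    have := Int.eq_one_or_neg_one_of_mul_eq_one (Int.cast_injective hmul)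
    omega
  · have hcos (t : ℝ) := cos_natCast_mul_toIcoMod_add n_x t 0
    simp only [add_zero] at hcos
    rw [hcos, hcos, cos_eq_cos_iff]
    refine ⟨-1, Or.inl ?_⟩
    push_cast
    field_simp
    ring
  · simp only [cos_natCast_mul_toIcoMod_add]
    exact cos_mul_add_eq_cos_mul_sub hsy _
  · simp only [cos_natCast_mul_toIcoMod_add]
    exact cos_mul_add_eq_cos_mul_sub hsz _
end

section
/- Let n_x, n_y, n_z be positive integers with gcd(n_x, n_z) = 1, let φ_y, φ_z ∈ ℝ, let k, j be integers with 1 ≤ k ≤ n_x − 1, and set t₁ = (−k/n_x + j/n_y)π − φ_y/n_y and t₂ = (k/n_x + j/n_y)π − φ_y/n_y. Then cos(n_z t₁ + φ_z) = cos(n_z t₂ + φ_z) if and only if there exists an integer m with φ_z = (n_z/n_y)φ_y + (m·n_y − j·n_z)π/n_y. -/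
open Real

/-- Two points symmetric about `c` have equal cosine iff `sin c` or `sin d` vanishes. -/
theorem cos_sub_eq_cos_add_iff (c d : ℝ) :
    cos (c - d) = cos (c + d) ↔ sin c = 0 ∨ sin d = 0 := by
  rw [cos_sub, cos_add, ← mul_eq_zero]
  constructor <;> intro h <;> linarith

/-- If `n` and `p` are coprime and `0 < k < n`, then `p * (k / n) * π` is not a zero of `sin`. -/
theorem sin_coprime_mul_div_mul_pi_ne_zero {n p : ℕ} (hnp : n.Coprime p) {k : ℤ}
    (hk0 : 0 < k) (hkn : k < n) : sin ((p : ℝ) * (k / n) * π) ≠ 0 := by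
  intro h
  obtain ⟨m, hm⟩ := sin_eq_zero_iff.mp h
  have hn : (n : ℝ) ≠ 0 := by
    have : n ≠ 0 := by lia
    exact_mod_cast this
  have hm' : (m : ℝ) = p * (k / n) := mul_right_cancel₀ pi_ne_zero hm
  field_simp at hm'
  have hdvd : (n : ℤ) ∣ p * k := ⟨m, by rw [mul_comm (n : ℤ)]; exact_mod_cast hm'.symm⟩
  have hcop : IsCoprime (n : ℤ) p := Nat.isCoprime_iff_coprime.mpr hnp
  have := Int.le_of_dvd hk0 (hcop.dvd_of_dvd_mul_left hdvd)
  lia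

/-- A Type I crossing with parameters (k, j) is singular exactly on the lines
`φ_z = (n_z/n_y) φ_y + (m n_y − j n_z) π / n_y`. -/
theorem typeI_singular_iff
    (n_x n_y n_z : ℕ) (hx : 0 < n_x) (hy : 0 < n_y) (hz : 0 < n_z)
    (hxz : Nat.Coprime n_x n_z)
    (φ_y φ_z : ℝ) (k j : ℤ) (hk1 : 1 ≤ k) (hk2 : k ≤ (n_x : ℤ) - 1) :
    cos ((n_z : ℝ) * (((-(k : ℝ) / n_x + (j : ℝ) / n_y) * π) - φ_y / n_y) + φ_z) =
      cos ((n_z : ℝ) * ((((k : ℝ) / n_x + (j : ℝ) / n_y) * π) - φ_y / n_y) + φ_z)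
    ↔ ∃ m : ℤ,
        φ_z = (n_z : ℝ) / (n_y : ℝ) * φ_y +
          ((m : ℝ) * n_y - (j : ℝ) * n_z) * π / n_y := by
  have hy' : (n_y : ℝ) ≠ 0 := by exact_mod_cast hy.ne'
  have h₁ : (n_z : ℝ) * (((-(k : ℝ) / n_x + (j : ℝ) / n_y) * π) - φ_y / n_y) + φ_z =
      (n_z * (j / n_y * π - φ_y / n_y) + φ_z) - n_z * (k / n_x) * π := by ring
  have h₂ : (n_z : ℝ) * ((((k : ℝ) / n_x + (j : ℝ) / n_y) * π) - φ_y / n_y) + φ_z =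
      (n_z * (j / n_y * π - φ_y / n_y) + φ_z) + n_z * (k / n_x) * π := by ring
  rw [h₁, h₂, cos_sub_eq_cos_add_iff,
    or_iff_left (sin_coprime_mul_div_mul_pi_ne_zero hxz (by lia) (by lia)), sin_eq_zero_iff]
  refine exists_congr fun m => ?_
  have hm : (n_z : ℝ) / n_y * φ_y + (m * n_y - j * n_z) * π / n_y =
      m * π - n_z * (j / n_y * π - φ_y / n_y) := by
    field_simp
    ring
  rw [hm]
  constructor <;> intro h <;> linarith
end

section
/- Let n_x, n_y, n_z be positive integers, let k, j, l, m be integers with j·n_z + l = m·n_y, let φ_y, ε ∈ ℝ, and set φ_z = (n_z/n_y)φ_y + l·π/n_y + ε, t₁ = (−k/n_x + j/n_y)π − φ_y/n_y, and t₂ = (k/n_x + j/n_y)π − φ_y/n_y. Then cos(n_z t₁ + φ_z) − cos(n_z t₂ + φ_z) = (−1)^m · 2 · sin(ε) · sin(k·n_z·π/n_x). -/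
open Real

/-- Crossing the diagonal singular line: the height difference of the z-coordinate
over a Type I crossing equals `(-1)^m · 2 sin ε · sin(k n_z π / n_x)`. -/
theorem typeI_height_difference
    (n_x n_y n_z : ℕ) (hx : 0 < n_x) (hy : 0 < n_y) (hz : 0 < n_z)
    (k j l m : ℤ) (hjl : j * n_z + l = m * n_y)
    (φ_y ε : ℝ) :
    cos ((n_z : ℝ) * (((-(k : ℝ) / n_x + (j : ℝ) / n_y) * π) - φ_y / n_y) +
        ((n_z : ℝ) / (n_y : ℝ) * φ_y + (l : ℝ) * π / n_y + ε)) -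
      cos ((n_z : ℝ) * ((((k : ℝ) / n_x + (j : ℝ) / n_y) * π) - φ_y / n_y) +
        ((n_z : ℝ) / (n_y : ℝ) * φ_y + (l : ℝ) * π / n_y + ε))
    = (-1 : ℝ) ^ m * 2 * sin ε * sin ((k : ℝ) * n_z * π / n_x) := by
  have hy' : (n_y : ℝ) ≠ 0 := by positivity
  have hl : (l : ℝ) = m * n_y - j * n_z := by
    have h : (j : ℝ) * n_z + l = m * n_y := by exact_mod_cast hjl
    linarith
  have h₁ : (n_z : ℝ) * (((-(k : ℝ) / n_x + (j : ℝ) / n_y) * π) - φ_y / n_y) +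
      ((n_z : ℝ) / (n_y : ℝ) * φ_y + (l : ℝ) * π / n_y + ε) =
      (ε - (k : ℝ) * n_z * π / n_x) + m * π := by
    rw [hl]
    field_simp
    ring
  have h₂ : (n_z : ℝ) * ((((k : ℝ) / n_x + (j : ℝ) / n_y) * π) - φ_y / n_y) +
      ((n_z : ℝ) / (n_y : ℝ) * φ_y + (l : ℝ) * π / n_y + ε) =
      (ε + (k : ℝ) * n_z * π / n_x) + m * π := by
    rw [hl]
    field_simp
    ring
  rw [h₁, h₂, cos_add_int_mul_pi, cos_add_int_mul_pi, cos_sub, cos_add]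
  ring
end

section
/- Let n_x, n_y, n_z be positive integers, let k, j be integers, let φ_y, ε ∈ ℝ, and set t₁ = (−k/n_x + j/n_y)π − φ_y/n_y, t₂ = (k/n_x + j/n_y)π − φ_y/n_y, n_z' = n_z + 2·n_x·n_y, φ_z = (n_z/n_y)φ_y − ε, and φ_z' = (n_z'/n_y)φ_y − ε. Then cos(n_z t₁ + φ_z) − cos(n_z t₂ + φ_z) = cos(n_z' t₁ + φ_z') − cos(n_z' t₂ + φ_z'). -/
open Real

/-- The height `cos (a * t + φ)` at a crossing time `t` is unchanged when the frequency `a` is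
raised by `2 * m * n` and the phase is adjusted accordingly. -/
theorem cos_height_add_two_mul (m n : ℕ) (hm : m ≠ 0) (hn : n ≠ 0) (k j : ℤ) (a φ ε : ℝ) :
    cos ((a + 2 * m * n) * (((k : ℝ) / m + (j : ℝ) / n) * π - φ / n) +
        ((a + 2 * m * n) / (n : ℝ) * φ - ε)) =
      cos (a * (((k : ℝ) / m + (j : ℝ) / n) * π - φ / n) + (a / (n : ℝ) * φ - ε)) := by
  rw [← cos_add_int_mul_two_pi (a * _ + _) (k * n + j * m)]
  congr 1
  push_cast
  field_simp
  ring

/-- The height difference of the z-coordinate over a Type I crossing is the same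
for z-frequency `n_z` with phase `(n_z/n_y)φ_y − ε` as for z-frequency
`n_z + 2 n_x n_y` with correspondingly adjusted phase. -/
theorem typeI_height_difference_periodicity
    (n_x n_y n_z : ℕ) (hx : 0 < n_x) (hy : 0 < n_y) (hz : 0 < n_z)
    (k j : ℤ) (φ_y ε : ℝ) :
    cos ((n_z : ℝ) * (((-(k : ℝ) / n_x + (j : ℝ) / n_y) * π) - φ_y / n_y) +
        ((n_z : ℝ) / (n_y : ℝ) * φ_y - ε)) -
      cos ((n_z : ℝ) * ((((k : ℝ) / n_x + (j : ℝ) / n_y) * π) - φ_y / n_y) +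
        ((n_z : ℝ) / (n_y : ℝ) * φ_y - ε))
    = cos (((n_z : ℝ) + 2 * n_x * n_y) * (((-(k : ℝ) / n_x + (j : ℝ) / n_y) * π) - φ_y / n_y) +
        (((n_z : ℝ) + 2 * n_x * n_y) / (n_y : ℝ) * φ_y - ε)) -
      cos (((n_z : ℝ) + 2 * n_x * n_y) * ((((k : ℝ) / n_x + (j : ℝ) / n_y) * π) - φ_y / n_y) +
        (((n_z : ℝ) + 2 * n_x * n_y) / (n_y : ℝ) * φ_y - ε)) := by
  have h₁ := cos_height_add_two_mul n_x n_y hx.ne' hy.ne' (-k) j n_z φ_y ε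
  have h₂ := cos_height_add_two_mul n_x n_y hx.ne' hy.ne' k j n_z φ_y ε
  push_cast at h₁
  rw [h₁, h₂]
end

section
/- Let n_x, n_y, n_z be positive integers with gcd(n_x, n_y) = 1, and let φ_y, φ_z ∈ ℝ. Then there exist φ_y' ∈ [0, π/n_x], φ_z' ∈ [0, π], and signs ε₁, ε₂, ε₃ ∈ {1, −1} such that the set {(cos(n_x t), cos(n_y t + φ_y'), cos(n_z t + φ_z')) : t ∈ ℝ} equals the image of the set {(cos(n_x s), cos(n_y s + φ_y), cos(n_z s + φ_z)) : s ∈ ℝ} under the map (a, b, c) ↦ (ε₁ a, ε₂ b, ε₃ c). -/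
open Real

/-- Shifting the argument of `cos` by an integer multiple of `π` multiplies it by a sign. -/
theorem exists_sign_cos_add_int_mul_pi (k : ℤ) :
    ∃ ε : ℝ, (ε = 1 ∨ ε = -1) ∧ ∀ x, cos (x + k * π) = ε * cos x := by
  refine ⟨(-1) ^ k, ?_, fun x => cos_add_int_mul_pi x k⟩
  rcases Int.even_or_odd k with h | h
  · exact Or.inl h.neg_one_zpow
  · exact Or.inr h.neg_one_zpow

/-- Every real number has an integer translate by a positive `p` in `[0, p]`. -/
theorem exists_add_int_mul_mem_Icc {p : ℝ} (hp : 0 < p) (b : ℝ) :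
    ∃ j : ℤ, b + j * p ∈ Set.Icc 0 p := by
  obtain ⟨j, hj, -⟩ := existsUnique_add_zsmul_mem_Ico hp b 0
  rw [zsmul_eq_mul, zero_add] at hj
  exact ⟨j, hj.1, hj.2.le⟩

/-- Fundamental domain: any Lissajous curve agrees, up to reflections in the
coordinate planes, with one whose phase shifts lie in `[0, π/n_x] × [0, π]`. -/
theorem lissajous_fundamental_domain
    (n_x n_y n_z : ℕ) (hx : 0 < n_x) (hy : 0 < n_y) (hz : 0 < n_z)
    (hxy : Nat.Coprime n_x n_y)
    (φ_y φ_z : ℝ) :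
    ∃ φ_y' ∈ Set.Icc (0 : ℝ) (π / n_x), ∃ φ_z' ∈ Set.Icc (0 : ℝ) π,
      ∃ ε₁ ε₂ ε₃ : ℝ,
        (ε₁ = 1 ∨ ε₁ = -1) ∧ (ε₂ = 1 ∨ ε₂ = -1) ∧ (ε₃ = 1 ∨ ε₃ = -1) ∧
        {p : ℝ × ℝ × ℝ | ∃ t : ℝ,
            p = (cos ((n_x : ℝ) * t),
                 cos ((n_y : ℝ) * t + φ_y'),
                 cos ((n_z : ℝ) * t + φ_z'))}
        = (fun p : ℝ × ℝ × ℝ => (ε₁ * p.1, ε₂ * p.2.1, ε₃ * p.2.2)) ''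
          {p : ℝ × ℝ × ℝ | ∃ s : ℝ,
            p = (cos ((n_x : ℝ) * s),
                 cos ((n_y : ℝ) * s + φ_y),
                 cos ((n_z : ℝ) * s + φ_z))} := by
  have hx0 : (n_x : ℝ) ≠ 0 := by positivity
  obtain ⟨j, hj⟩ := exists_add_int_mul_mem_Icc (p := π / n_x) (by positivity) φ_y
  obtain ⟨k, m, hkm⟩ : ∃ k m : ℤ, k * n_y + m * n_x = j := by
    obtain ⟨a, b, hab⟩ := Nat.isCoprime_iff_coprime.mpr hxy
    exact ⟨j * b, j * a, by linear_combination j * hab⟩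
  have hkm' : (k : ℝ) * n_y + m * n_x = j := by exact_mod_cast hkm
  obtain ⟨l, hl⟩ := exists_add_int_mul_mem_Icc pi_pos (φ_z + k * n_z * π / n_x)
  obtain ⟨ε₁, hε₁, h₁⟩ := exists_sign_cos_add_int_mul_pi (-k)
  obtain ⟨ε₂, hε₂, h₂⟩ := exists_sign_cos_add_int_mul_pi m
  obtain ⟨ε₃, hε₃, h₃⟩ := exists_sign_cos_add_int_mul_pi l
  have key (s : ℝ) :
      (cos (n_x * (s - k * π / n_x)),
        cos (n_y * (s - k * π / n_x) + (φ_y + j * (π / n_x))),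
        cos (n_z * (s - k * π / n_x) + (φ_z + k * n_z * π / n_x + l * π))) =
      (ε₁ * cos (n_x * s), ε₂ * cos (n_y * s + φ_y), ε₃ * cos (n_z * s + φ_z)) := by
    rw [← h₁, ← h₂, ← h₃, ← hkm']
    refine Prod.ext (congrArg cos ?_) (Prod.ext (congrArg cos ?_) (congrArg cos ?_)) <;>
      push_cast <;> field_simp <;> ring
  refine ⟨_, hj, _, hl, ε₁, ε₂, ε₃, hε₁, hε₂, hε₃, ?_⟩
  ext p
  constructor
  · rintro ⟨t, rfl⟩
    refine ⟨_, ⟨t + k * π / n_x, rfl⟩, ?_⟩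
    simpa only [add_sub_cancel_right] using (key (t + k * π / n_x)).symm
  · rintro ⟨_, ⟨s, rfl⟩, rfl⟩
    exact ⟨s - k * π / n_x, (key s).symm⟩
end

section
/- Let n_y = 2a + 1 and n_z = 2b + 1 be odd positive integers (a, b ∈ ℕ) and let φ_y, φ_z ∈ ℝ. Then for all t ∈ ℝ: cos(2(−t + π/2)) = −cos(2t), cos(n_y(−t + π/2) + π/2 − φ_y) = (−1)^{a+1}·cos(n_y t + φ_y), and cos(n_z(−t + π/2) + π/2 − φ_z) = (−1)^{b+1}·cos(n_z t + φ_z). Consequently the curve K'(t) = (cos 2t, cos(n_y t + π/2 − φ_y), cos(n_z t + π/2 − φ_z)) satisfies K'(−t + π/2) = (−cos 2t, (−1)^{a+1}cos(n_y t + φ_y), (−1)^{b+1}cos(n_z t + φ_z)). -/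
open Real

theorem cos_odd_mul_reflect (n : ℕ) (φ t : ℝ) :
    cos ((2 * (n : ℝ) + 1) * (-t + π / 2) + (π / 2 - φ))
      = (-1 : ℝ) ^ (n + 1) * cos ((2 * (n : ℝ) + 1) * t + φ) := by
  rw [← cos_nat_mul_pi_sub]
  congr 1
  push_cast
  ring

/-- The computation behind the `n_x = 2` symmetry of the phase torus: phase pairs
symmetric about `(π/4, π/4)` give the same curve up to reparameterization and
reflections. -/
theorem nx_eq_two_symmetry
    (a b : ℕ) (φ_y φ_z : ℝ) :
    ∀ t : ℝ,
      cos (2 * (-t + π / 2)) = -cos (2 * t) ∧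
      cos ((2 * (a : ℝ) + 1) * (-t + π / 2) + (π / 2 - φ_y))
        = (-1 : ℝ) ^ (a + 1) * cos ((2 * (a : ℝ) + 1) * t + φ_y) ∧
      cos ((2 * (b : ℝ) + 1) * (-t + π / 2) + (π / 2 - φ_z))
        = (-1 : ℝ) ^ (b + 1) * cos ((2 * (b : ℝ) + 1) * t + φ_z) ∧
      (cos (2 * (-t + π / 2)),
       cos ((2 * (a : ℝ) + 1) * (-t + π / 2) + (π / 2 - φ_y)),
       cos ((2 * (b : ℝ) + 1) * (-t + π / 2) + (π / 2 - φ_z)))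
      = (-cos (2 * t),
         (-1 : ℝ) ^ (a + 1) * cos ((2 * (a : ℝ) + 1) * t + φ_y),
         (-1 : ℝ) ^ (b + 1) * cos ((2 * (b : ℝ) + 1) * t + φ_z)) := by
  intro t
  have hx : cos (2 * (-t + π / 2)) = -cos (2 * t) := by
    rw [← cos_pi_sub]
    congr 1
    ring
  have hy := cos_odd_mul_reflect a φ_y t
  have hz := cos_odd_mul_reflect b φ_z t
  exact ⟨hx, hy, hz, by rw [hx, hy, hz]⟩
end

section
/- Let n_x, n_y, n₁, n₂ be positive integers, let A, φ₁, φ₂ ∈ ℝ, let k, j be integers, and set t₁ = (−k/n_y + j/n_x)π, t₂ = (k/n_y + j/n_x)π, and z(t) = cos(n₁ t + φ₁) + A·cos(n₂ t + φ₂). Then z(t₁) = z(t₂) if and only if sin(n₁·j·π/n_x + φ₁)·sin(n₁·k·π/n_y) = −A·sin(n₂·j·π/n_x + φ₂)·sin(n₂·k·π/n_y). -/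
open Real

/-- Difference of the values of a cosine at points reflected about `c * π`, as a product of sines. -/
lemma cos_neg_add_sub_cos_add (n a c φ : ℝ) :
    cos (n * ((-a + c) * π) + φ) - cos (n * ((a + c) * π) + φ)
      = 2 * (sin (n * c * π + φ) * sin (n * a * π)) := by
  have h₁ : n * ((-a + c) * π) + φ = (n * c * π + φ) - n * a * π := by ring
  have h₂ : n * ((a + c) * π) + φ = (n * c * π + φ) + n * a * π := by ring
  rw [h₁, h₂, cos_sub, cos_add (n * c * π + φ)]
  ring

/-- Singularity criterion for a Type II crossing of a Fourier-(1,1,2) knot. -/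
theorem fourier112_typeII_singular_iff
    (n_x n_y n₁ n₂ : ℕ) (hx : 0 < n_x) (hy : 0 < n_y) (h1 : 0 < n₁) (h2 : 0 < n₂)
    (A φ₁ φ₂ : ℝ) (k j : ℤ) :
    (cos ((n₁ : ℝ) * ((-(k : ℝ) / n_y + (j : ℝ) / n_x) * π) + φ₁) +
        A * cos ((n₂ : ℝ) * ((-(k : ℝ) / n_y + (j : ℝ) / n_x) * π) + φ₂)
      = cos ((n₁ : ℝ) * (((k : ℝ) / n_y + (j : ℝ) / n_x) * π) + φ₁) +
        A * cos ((n₂ : ℝ) * (((k : ℝ) / n_y + (j : ℝ) / n_x) * π) + φ₂))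
    ↔ sin ((n₁ : ℝ) * j * π / n_x + φ₁) * sin ((n₁ : ℝ) * k * π / n_y)
      = -A * (sin ((n₂ : ℝ) * j * π / n_x + φ₂) * sin ((n₂ : ℝ) * k * π / n_y)) := by
  have e₁ := cos_neg_add_sub_cos_add n₁ (k / n_y) (j / n_x) φ₁
  have e₂ := cos_neg_add_sub_cos_add n₂ (k / n_y) (j / n_x) φ₂
  simp only [← neg_div, mul_div_assoc', div_mul_eq_mul_div] at e₁ e₂ ⊢
  constructor <;> intro h
  · linear_combination h / 2 - e₁ / 2 - A * e₂ / 2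
  · linear_combination 2 * h + e₁ + A * e₂
end

section
/- Let n_x, n_y, n_z be positive integers with gcd(n_x, n_y) = 1 and gcd(n_y, n_z) = 1, let φ_y ∈ ℝ satisfy n_x·φ_y/π ∉ ℤ, and let l be an integer. Then the number of pairs of integers (k, j) with 1 ≤ k ≤ n_x − 1, 1 + ⌊(n_y/n_x)k + φ_y/π⌋ ≤ j ≤ ⌊2n_y − (n_y/n_x)k + φ_y/π⌋, and n_y ∣ (j·n_z + l) equals n_x − 1. -/
open Real

theorem exists_forall_dvd_mul_add_iff_modEq {a n : ℕ} (h : Nat.Coprime n a) (l : ℤ) :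
    ∃ r : ℤ, ∀ j : ℤ, (n : ℤ) ∣ j * a + l ↔ j ≡ r [ZMOD n] := by
  have hc : IsCoprime (n : ℤ) (a : ℤ) := Nat.isCoprime_iff_coprime.mpr h
  obtain ⟨u, v, huv⟩ := id hc
  refine ⟨-(v * l), fun j => ?_⟩
  have hj : j * a + l = (j + v * l) * a + n * (u * l) := by
    linear_combination -l * huv
  rw [hj, dvd_add_left (dvd_mul_right _ _), Int.modEq_comm, Int.modEq_iff_dvd, sub_neg_eq_add]
  exact ⟨hc.dvd_of_dvd_mul_right, fun hd => hd.mul_right _⟩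

theorem ncard_prod_eq_sum_card {α β : Type*} (s : Finset α) (t : α → Finset β) :
    {p : α × β | p.1 ∈ s ∧ p.2 ∈ t p.1}.ncard = ∑ a ∈ s, (t a).card := by
  have h : {p : α × β | p.1 ∈ s ∧ p.2 ∈ t p.1} =
      ((s.sigma t).map (Equiv.sigmaEquivProd α β).toEmbedding : Set (α × β)) := by
    ext ⟨a, b⟩
    simp
  rw [h, Set.ncard_coe_finset, Finset.card_map, Finset.card_sigma]

theorem sum_Icc_eq_of_add_reflect_eq_two {n : ℕ} (hn : 0 < n) (N : ℤ → ℕ)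
    (h : ∀ k ∈ Finset.Icc 1 ((n : ℤ) - 1), N k + N (n - k) = 2) :
    ∑ k ∈ Finset.Icc 1 ((n : ℤ) - 1), N k = n - 1 := by
  have hr : ∑ k ∈ Finset.Icc 1 ((n : ℤ) - 1), N k =
      ∑ k ∈ Finset.Icc 1 ((n : ℤ) - 1), N (n - k) := by
    refine Finset.sum_nbij' (fun k => n - k) (fun k => n - k) ?_ ?_ ?_ ?_ ?_ <;>
      intro k hk <;> simp only [Finset.mem_Icc, sub_sub_cancel] at * <;> omega
  have hs := Finset.sum_congr rfl h
  rw [Finset.sum_add_distrib, ← hr, Finset.sum_const, Int.card_Icc, smul_eq_mul] at hs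
  omega

theorem card_Ioc_filter_modEq_add_reflect {m : ℕ} (hm : 0 < m) (r a b : ℤ)
    (hab : a ≤ m + b) (hba : b ≤ m + a) :
    ((Finset.Ioc a (m + b)).filter (· ≡ r [ZMOD m])).card +
      ((Finset.Ioc b (m + a)).filter (· ≡ r [ZMOD m])).card = 2 := by
  have hm' : (0 : ℤ) < m := by exact_mod_cast hm
  have hq : (m : ℚ) ≠ 0 := by positivity
  have key : ∀ x y : ℤ, x ≤ m + y →
      (((Finset.Ioc x (m + y)).filter (· ≡ r [ZMOD m])).card : ℤ) =
        ⌊((y : ℚ) - r) / m⌋ + 1 - ⌊((x : ℚ) - r) / m⌋ := by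
    intro x y hxy
    have hs : (((m + y : ℤ) : ℚ) - r) / m = ((y : ℚ) - r) / m + 1 := by
      push_cast
      field_simp
      ring
    have hle : ⌊((x : ℚ) - r) / m⌋ ≤ ⌊((y : ℚ) - r) / m⌋ + 1 := by
      rw [← Int.floor_add_one, ← hs]
      have : (x : ℚ) ≤ ((m + y : ℤ) : ℚ) := by exact_mod_cast hxy
      gcongr
    rw [Int.Ioc_filter_modEq_card _ _ hm', Int.cast_natCast, hs, Int.floor_add_one,
      max_eq_left (by linarith)]
  have h₁ := key a b hab
  have h₂ := key b a hba
  omega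

/-- Exactly `n_x − 1` Type I crossings change when the phase shifts cross the
diagonal singular line with parameter `l`. -/
theorem count_typeI_crossings_changed
    (n_x n_y n_z : ℕ) (hx : 0 < n_x) (hy : 0 < n_y) (hz : 0 < n_z)
    (hxy : Nat.Coprime n_x n_y) (hyz : Nat.Coprime n_y n_z)
    (φ_y : ℝ) (hφ : ¬ ∃ m : ℤ, (n_x : ℝ) * φ_y / π = m)
    (l : ℤ) :
    {p : ℤ × ℤ | 1 ≤ p.1 ∧ p.1 ≤ (n_x : ℤ) - 1 ∧
      1 + ⌊(n_y : ℝ) / (n_x : ℝ) * p.1 + φ_y / π⌋ ≤ p.2 ∧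
      p.2 ≤ ⌊2 * (n_y : ℝ) - (n_y : ℝ) / (n_x : ℝ) * p.1 + φ_y / π⌋ ∧
      (n_y : ℤ) ∣ (p.2 * n_z + l)}.ncard
    = n_x - 1 := by
  obtain ⟨r, hr⟩ := exists_forall_dvd_mul_add_iff_modEq hyz l
  have hx' : (0 : ℝ) < n_x := by exact_mod_cast hx
  set A : ℤ → ℤ := fun k => ⌊(n_y : ℝ) / n_x * k + φ_y / π⌋ with hA
  have hB : ∀ k : ℤ, ⌊2 * (n_y : ℝ) - (n_y : ℝ) / n_x * k + φ_y / π⌋ = n_y + A (n_x - k) := by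
    intro k
    rw [hA, ← Int.floor_natCast_add]
    congr 1
    push_cast
    field_simp
    ring
  have hle : ∀ k ∈ Finset.Icc 1 ((n_x : ℤ) - 1), A k ≤ n_y + A (n_x - k) := by
    intro k hk
    rw [← hB]
    apply Int.floor_le_floor
    have hk' : (k : ℝ) ≤ n_x := by
      have := (Finset.mem_Icc.mp hk).2
      exact_mod_cast (by omega : k ≤ n_x)
    have : (n_y : ℝ) / n_x * k ≤ n_y / n_x * n_x := by gcongr
    rw [div_mul_cancel₀ _ hx'.ne'] at this
    linarith
  let t : ℤ → Finset ℤ := fun k =>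
    (Finset.Ioc (A k) (n_y + A (n_x - k))).filter (· ≡ r [ZMOD n_y])
  have hset : {p : ℤ × ℤ | 1 ≤ p.1 ∧ p.1 ≤ (n_x : ℤ) - 1 ∧
      1 + ⌊(n_y : ℝ) / (n_x : ℝ) * p.1 + φ_y / π⌋ ≤ p.2 ∧
      p.2 ≤ ⌊2 * (n_y : ℝ) - (n_y : ℝ) / (n_x : ℝ) * p.1 + φ_y / π⌋ ∧
      (n_y : ℤ) ∣ (p.2 * n_z + l)} =
      {p : ℤ × ℤ | p.1 ∈ Finset.Icc 1 ((n_x : ℤ) - 1) ∧ p.2 ∈ t p.1} := by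
    ext ⟨k, j⟩
    simp only [Set.mem_ofPred_eq, Finset.mem_Icc, t, Finset.mem_filter, Finset.mem_Ioc, hr, hB,
      and_assoc, ← Int.add_one_le_iff, add_comm (1 : ℤ), hA]
  rw [hset, ncard_prod_eq_sum_card]
  refine sum_Icc_eq_of_add_reflect_eq_two hx _ fun k hk => ?_
  have hk' : (n_x : ℤ) - k ∈ Finset.Icc 1 ((n_x : ℤ) - 1) := by
    rw [Finset.mem_Icc] at *
    omega
  have h := hle _ hk'
  rw [sub_sub_cancel] at h
  simpa only [t, sub_sub_cancel] using card_Ioc_filter_modEq_add_reflect hy r _ _ (hle k hk) h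
end
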